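/- arXiv:0902.0152 — 2 statements merged into one kernel-verified Lean document; each statement's English description precedes it below -/
import Mathlib

section
/- Let Λ be the fundamental weight with simple root α_Λ, and let w = s_{α_1}···s_{α_l} be a reduced expression of an element of the Weyl group W. If w is Λ-minuscule, then no α_i is shorter than α_Λ, i.e. (α_i, α_i) ≥ (α_Λ, α_Λ) for every i ∈ {1,…,l}; and if w is Λ-cominuscule, then no α_i is longer than α_Λ, i.e. (α_i, α_i) ≤ (α_Λ, α_Λ) for every i ∈ {1,…,l}. -/
namespace KM

/-! ## Jeu de taquin on posets (parametrized by an order relation `r`) -/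

namespace JDT

variable {P : Type}

/-- `S` is a lower set (order ideal) for the relation `r`. -/
def IsIdeal (r : P → P → Prop) (S : Set P) : Prop :=
  ∀ ⦃x y : P⦄, r x y → y ∈ S → x ∈ S

/-- `y` covers `x` for the order relation `r`. -/
def Cov (r : P → P → Prop) (x y : P) : Prop :=
  r x y ∧ x ≠ y ∧ ∀ z : P, r x z → r z y → z = x ∨ z = y

/-- A standard tableau for the order relation `r`: a finite set of boxes, labelled
strictly increasingly (w.r.t. `r`) and bijectively by `{1, …, n}`. -/
structure Tab (r : P → P → Prop) where
  dom : Set P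
  finite : dom.Finite
  lab : P → ℕ
  mono : ∀ ⦃x y : P⦄, x ∈ dom → y ∈ dom → r x y → x ≠ y → lab x < lab y
  bij : Set.BijOn lab dom (Set.Icc 1 dom.ncard)

/-- A configuration occurring during a jeu de taquin slide: a set of labelled boxes,
the labelling, and the position of the vacant box. -/
structure Cfg (P : Type) where
  dom : Set P
  lab : P → ℕ
  hole : P

/-- One elementary move inside a jeu de taquin slide: among the labelled boxes covering
the vacant box, the one with the smallest label moves its label into the vacant box,
becoming itself vacant. -/
def InnerStep (r : P → P → Prop) (s t : Cfg P) : Prop :=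
  t.hole ∈ s.dom ∧ Cov r s.hole t.hole ∧
  (∀ z ∈ s.dom, Cov r s.hole z → s.lab t.hole ≤ s.lab z) ∧
  t.dom = insert s.hole (s.dom \ {t.hole}) ∧
  t.lab s.hole = s.lab t.hole ∧ (∀ z : P, z ≠ s.hole → t.lab z = s.lab z)

/-- No labelled box covers the vacant box: the slide stops. -/
def Terminal (r : P → P → Prop) (s : Cfg P) : Prop :=
  ∀ z ∈ s.dom, ¬ Cov r s.hole z

/-- `x` is a valid vacant box to slide into: it lies strictly below some labelled box,
and is maximal among the unlabelled boxes lying strictly below some labelled box. -/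
def IsSlideBox (r : P → P → Prop) (D : Set P) (x : P) : Prop :=
  x ∉ D ∧ (∃ d ∈ D, r x d ∧ x ≠ d) ∧
  ∀ y : P, y ∉ D → (∃ d ∈ D, r y d ∧ y ≠ d) → r x y → x = y

/-- The jeu de taquin slide `j_x` : relation between the labelled configurations
before and after one full slide. -/
def SlideRel (r : P → P → Prop) (A B : Set P × (P → ℕ)) : Prop :=
  ∃ x : P, IsSlideBox r A.1 x ∧
    ∃ e : Cfg P, Relation.ReflTransGen (InnerStep r) ⟨A.1, A.2, x⟩ e ∧
      Terminal r e ∧ B.1 = e.dom ∧ B.2 = e.lab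

/-- `R` is a rectification of `T`: it is obtained from `T` by iterating jeu de taquin
slides, and its shape is an order ideal. -/
def RectifiesTo (r : P → P → Prop) (T R : Tab r) : Prop :=
  Relation.ReflTransGen (SlideRel r) (T.dom, T.lab) (R.dom, R.lab) ∧ IsIdeal r R.dom

/-- The poset has the jeu de taquin property: the rectification of any standard tableau
is independent of all choices made while performing the slides. -/
def HasJdt (r : P → P → Prop) : Prop :=
  ∀ T R R' : Tab r, RectifiesTo r T R → RectifiesTo r T R' → R.dom = R'.dom ∧ R.lab = R'.lab

open scoped Classical in
/-- The jeu de taquin number `t_{λ,μ}^ν`, relative to a choice `U` of a standard tableau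
of each straight shape: the number of standard tableaux of skew shape `ν/λ` whose
rectification is `U μ`; it is `0` if `λ ⊄ ν`. -/
noncomputable def tP (r : P → P → Prop) (U : Set P → Tab r) (lam mu nu : Set P) : ℕ :=
  if lam ⊆ nu then
    Set.ncard {T : Tab r | T.dom = nu \ lam ∧ RectifiesTo r T (U mu)}
  else 0

end JDT

/-! ## Symmetrizable generalized Cartan matrices and their Weyl groups -/

/-- A symmetrizable generalized Cartan matrix `a i j = ⟨α_j, α_i^∨⟩`, together with a
symmetrizer `d` (so that `(α_i, α_j) = d i * a i j` is a symmetric bilinear form with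
`(α_i, α_i) = 2 * d i`). -/
structure SGCM (I : Type) where
  a : I → I → ℤ
  d : I → ℝ
  a_diag : ∀ i, a i i = 2
  a_offdiag : ∀ i j, i ≠ j → a i j ≤ 0
  a_zero_iff : ∀ i j, a i j = 0 → a j i = 0
  d_pos : ∀ i, 0 < d i
  symm : ∀ i j, d i * (a i j : ℝ) = d j * (a j i : ℝ)

variable {I : Type}

/-- The squared length `(α_i, α_i)` of the `i`-th simple root. -/
def SGCM.normSq (G : SGCM I) (i : I) : ℝ := 2 * G.d i

/-- The dual (transposed) generalized Cartan matrix, corresponding to exchanging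
roots and coroots. -/
noncomputable def SGCM.dual (G : SGCM I) : SGCM I where
  a i j := G.a j i
  d i := (G.d i)⁻¹
  a_diag i := G.a_diag i
  a_offdiag i j h := G.a_offdiag j i (Ne.symm h)
  a_zero_iff i j h := G.a_zero_iff j i h
  d_pos i := inv_pos.mpr (G.d_pos i)
  symm i j := by
    have h := G.symm j i
    have hi : G.d i ≠ 0 := ne_of_gt (G.d_pos i)
    have hj : G.d j ≠ 0 := ne_of_gt (G.d_pos j)
    rw [inv_mul_eq_div, inv_mul_eq_div, div_eq_div_iff hi hj]
    linear_combination h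

/-- The simple reflection `s_i` acting on weight coordinates: a weight `λ` is recorded
by its pairings `λ j = ⟨λ, α_j^∨⟩` with the simple coroots, and
`⟨s_i λ, α_j^∨⟩ = ⟨λ, α_j^∨⟩ - ⟨λ, α_i^∨⟩ ⟨α_i, α_j^∨⟩`. -/
def SGCM.srefl (G : SGCM I) (i : I) : Equiv.Perm (I → ℝ) :=
  Function.Involutive.toPerm (fun lam j => lam j - lam i * (G.a j i : ℝ)) (by
    intro lam
    funext j
    have h2 : ((G.a i i : ℤ) : ℝ) = 2 := by rw [G.a_diag i]; norm_num
    dsimp only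
    rw [h2]
    ring)

/-- The product `s_{l 1} ⋯ s_{l n}` of the simple reflections along a word. -/
def SGCM.wordProd (G : SGCM I) (l : List I) : Equiv.Perm (I → ℝ) :=
  (l.map G.srefl).prod

/-- The length of an element of the Weyl group: the minimal length of a word of simple
reflections expressing it. -/
noncomputable def SGCM.length (G : SGCM I) (w : Equiv.Perm (I → ℝ)) : ℕ :=
  sInf {n | ∃ l : List I, l.length = n ∧ G.wordProd l = w}

/-- A word is reduced if no shorter word has the same product. -/
def SGCM.IsReduced (G : SGCM I) (l : List I) : Prop :=
  G.length (G.wordProd l) = l.length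

/-- `w` belongs to the Weyl group (is a product of simple reflections). -/
def SGCM.InW (G : SGCM I) (w : Equiv.Perm (I → ℝ)) : Prop :=
  ∃ l : List I, G.wordProd l = w

/-- The (strong) Bruhat order on the Weyl group, via the subword property. -/
def SGCM.bruhatLE (G : SGCM I) (u w : Equiv.Perm (I → ℝ)) : Prop :=
  ∃ l : List I, G.IsReduced l ∧ G.wordProd l = w ∧
    ∃ l' : List I, l'.Sublist l ∧ G.wordProd l' = u

/-- Peterson's condition: the word `[β_1, …, β_l]` satisfies
`s_{β_k} s_{β_{k+1}} ⋯ s_{β_l} (Λ) = s_{β_{k+1}} ⋯ s_{β_l} (Λ) - β_k`, i.e.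
`⟨s_{β_{k+1}} ⋯ s_{β_l} (Λ), β_k^∨⟩ = 1`, for every `k`. -/
def SGCM.MinusculeWord (G : SGCM I) (Λ : I → ℝ) : List I → Prop
  | [] => True
  | j :: l => G.MinusculeWord Λ l ∧ G.wordProd l Λ j = 1

/-- `w` is `Λ`-minuscule. -/
def SGCM.IsMinuscule (G : SGCM I) (Λ : I → ℝ) (w : Equiv.Perm (I → ℝ)) : Prop :=
  ∃ l : List I, G.IsReduced l ∧ G.wordProd l = w ∧ G.MinusculeWord Λ l

/-- `w` is `Λ`-cominuscule: it is `Λ^∨`-minuscule for the dual root system (where the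
coweight `Λ^∨ = Σ Λ_i ϖ_i^∨` has the same coordinate function as `Λ`). -/
def SGCM.IsCominuscule (G : SGCM I) (Λ : I → ℝ) (w : Equiv.Perm (I → ℝ)) : Prop :=
  ∃ l : List I, G.IsReduced l ∧ G.wordProd l = w ∧ G.dual.MinusculeWord Λ l

/-- `w` is `Λ`-minuscule or `Λ`-cominuscule. -/
def SGCM.IsCoMin (G : SGCM I) (Λ : I → ℝ) (w : Equiv.Perm (I → ℝ)) : Prop :=
  G.IsMinuscule Λ w ∨ G.IsCominuscule Λ w

/-- The simple reflection `s_i` acting on the root lattice `⊕ ℤ α_j` (an element is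
recorded by its coordinates on the simple roots):
`s_i (x) = x - ⟨x, α_i^∨⟩ α_i` with `⟨Σ c_j α_j, α_i^∨⟩ = Σ c_j * a i j`. -/
noncomputable def SGCM.qrefl (G : SGCM I) (i : I) : Equiv.Perm (I →₀ ℤ) :=
  Function.Involutive.toPerm
    (fun x => x - Finsupp.single i (x.sum fun j c => c * G.a i j))
    (by
      intro x
      dsimp only
      have hsub : ∀ y z : I →₀ ℤ,
          ((y - z).sum fun j c => c * G.a i j)
            = (y.sum fun j c => c * G.a i j) - (z.sum fun j c => c * G.a i j) :=
        fun y z => Finsupp.sum_sub_index (fun a b₁ b₂ => by ring)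
      have hsingle : ∀ c : ℤ,
          ((Finsupp.single i c).sum fun j c' => c' * G.a i j) = c * 2 := by
        intro c
        rw [Finsupp.sum_single_index (by ring), G.a_diag i]
      rw [hsub, hsingle]
      have h : (x.sum fun j c => c * G.a i j) - (x.sum fun j c => c * G.a i j) * 2
          = -(x.sum fun j c => c * G.a i j) := by ring
      rw [h, Finsupp.single_neg]
      abel)

/-- The product of the simple reflections along a word, acting on the root lattice. -/
noncomputable def SGCM.qword (G : SGCM I) (l : List I) : Equiv.Perm (I →₀ ℤ) :=
  (l.map G.qrefl).prod

/-! ## Heaps of fully commutative elements -/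

/-- Generating relation for the heap order on the positions of a word: position `p` is
below position `q` when `p` comes later in the word and the corresponding simple
reflections do not commute. -/
def heapBelow (G : SGCM I) (l : List I) (p q : Fin l.length) : Prop :=
  q.1 < p.1 ∧ G.srefl (l.get p) * G.srefl (l.get q) ≠ G.srefl (l.get q) * G.srefl (l.get p)

/-- The heap order on the positions of a word. -/
def heapLE (G : SGCM I) (l : List I) : Fin l.length → Fin l.length → Prop :=
  Relation.ReflTransGen (heapBelow G l)

/-- The subword of `l` consisting of the positions in `S`, in the order of the word. -/
noncomputable def idealWord (l : List I) (S : Set (Fin l.length)) : List I :=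
  ((List.finRange l.length).filter fun p => @decide (p ∈ S) (Classical.propDecidable _)).map
    l.get

open scoped Classical in
/-- The number `m(w)` attached to a `Λ`-(co)minuscule element with reduced word `l`:
the product of `(α, α) / (α_p, α_p)` over all pairs `(p, α)` where `p` is a position of
the word, `α` is a simple root with `⟨Λ, α^∨⟩ > 0` and `(α, α) > (α_p, α_p)`, and `p`
lies above the minimal `α`-coloured element `(α, 1)` of the heap (here `q` runs over the
positions and the first condition states that `q = (α, 1)` for `α` the colour of `q`). -/
noncomputable def mNum (G : SGCM I) (Λ : I → ℝ) (l : List I) : ℝ :=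
  ∏ pq : Fin l.length × Fin l.length,
    if (∀ r, l.get r = l.get pq.2 → heapLE G l pq.2 r) ∧
        0 < Λ (l.get pq.2) ∧
        G.normSq (l.get pq.1) < G.normSq (l.get pq.2) ∧
        heapLE G l pq.2 pq.1
    then G.normSq (l.get pq.2) / G.normSq (l.get pq.1)
    else 1

/-! ## Jeu de taquin numbers for (co)minuscule elements -/

/-- A valid system of choices for computing jeu de taquin numbers of `Λ`-(co)minuscule
elements: `wrd w` is a reduced word for `w`; for `u ≤ w`, `idl w u` is the order ideal
of the heap of `w` corresponding to `u`, and `tab w u` is a standard tableau whose shape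
is that ideal. -/
def ValidChoices (G : SGCM I) (Λ : I → ℝ)
    (wrd : Equiv.Perm (I → ℝ) → List I)
    (idl : (w u : Equiv.Perm (I → ℝ)) → Set (Fin (wrd w).length))
    (tab : (w u : Equiv.Perm (I → ℝ)) → JDT.Tab (heapLE G (wrd w))) : Prop :=
  (∀ w, G.IsCoMin Λ w → G.IsReduced (wrd w) ∧ G.wordProd (wrd w) = w) ∧
  (∀ w u, G.IsCoMin Λ w → G.bruhatLE u w →
      JDT.IsIdeal (heapLE G (wrd w)) (idl w u) ∧
      G.wordProd (idealWord (wrd w) (idl w u)) = u) ∧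
  (∀ w u, G.IsCoMin Λ w → G.bruhatLE u w → (tab w u).dom = idl w u)

open scoped Classical in
/-- The jeu de taquin number `t_{u,v}^w` of three Weyl group elements, computed in the
heap of `w`: the number of standard tableaux of shape `H(w)/λ(u)` rectifying to the
chosen standard tableau of shape `λ(v)`; it is `0` unless `u ≤ w` and `v ≤ w`. -/
noncomputable def tE (G : SGCM I)
    (wrd : Equiv.Perm (I → ℝ) → List I)
    (idl : (w u : Equiv.Perm (I → ℝ)) → Set (Fin (wrd w).length))
    (tab : (w u : Equiv.Perm (I → ℝ)) → JDT.Tab (heapLE G (wrd w)))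
    (u v w : Equiv.Perm (I → ℝ)) : ℕ :=
  if G.bruhatLE u w ∧ G.bruhatLE v w then
    Set.ncard {T : JDT.Tab (heapLE G (wrd w)) |
      T.dom = Set.univ \ idl w u ∧ JDT.RectifiesTo (heapLE G (wrd w)) T (tab w v)}
  else 0

/-- The number `m_{u,v}^w = m(w) / (m(u) · m(v))`. -/
noncomputable def mQuot (G : SGCM I) (Λ : I → ℝ)
    (wrd : Equiv.Perm (I → ℝ) → List I)
    (u v w : Equiv.Perm (I → ℝ)) : ℝ :=
  mNum G Λ (wrd w) / (mNum G Λ (wrd u) * mNum G Λ (wrd v))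

/-- The set `S(x)` of simple roots `α` such that `⟨x(Λ), α^∨⟩ ≥ 0`. -/
def Sx (G : SGCM I) (Λ : I → ℝ) (x : Equiv.Perm (I → ℝ)) : Set I :=
  {α : I | 0 ≤ x Λ α}

/-- The restriction of a symmetrizable GCM to a subset of the index set. -/
def SGCM.restrict (G : SGCM I) (S : Set I) : SGCM ↥S where
  a i j := G.a i.1 j.1
  d i := G.d i.1
  a_diag i := G.a_diag i.1
  a_offdiag i j h := G.a_offdiag i.1 j.1 (fun hv => h (Subtype.ext hv))
  a_zero_iff i j h := G.a_zero_iff i.1 j.1 h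
  d_pos i := G.d_pos i.1
  symm i j := G.symm i.1 j.1

end KM

namespace KM

namespace SGCM

variable {I : Type} (G : SGCM I)

theorem srefl_apply (i : I) (lam : I → ℝ) (j : I) :
    G.srefl i lam j = lam j - lam i * (G.a j i : ℝ) := rfl

theorem srefl_mul_self (i : I) : G.srefl i * G.srefl i = 1 := by
  ext lam j
  simp only [Equiv.Perm.mul_apply, srefl_apply, G.a_diag, Equiv.Perm.one_apply]
  push_cast
  ring

theorem wordProd_nil : G.wordProd [] = 1 := rfl

theorem wordProd_cons (i : I) (l : List I) :
    G.wordProd (i :: l) = G.srefl i * G.wordProd l := by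
  simp [wordProd]

theorem wordProd_append (l m : List I) :
    G.wordProd (l ++ m) = G.wordProd l * G.wordProd m := by
  simp [wordProd]

theorem wordProd_cons_cons_self (i : I) (l : List I) :
    G.wordProd (i :: i :: l) = G.wordProd l := by
  rw [wordProd_cons, wordProd_cons, ← mul_assoc, srefl_mul_self, one_mul]

theorem wordProd_cons_congr {i : I} {l m : List I} (h : G.wordProd l = G.wordProd m) :
    G.wordProd (i :: l) = G.wordProd (i :: m) := by
  rw [wordProd_cons, wordProd_cons, h]

theorem IsReduced.length_le {G : SGCM I} {l m : List I} (hl : G.IsReduced l)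
    (h : G.wordProd m = G.wordProd l) : l.length ≤ m.length := by
  rw [← hl]
  exact Nat.sInf_le ⟨m, rfl, h⟩

theorem isReduced_of_forall_length_le {G : SGCM I} {l : List I}
    (h : ∀ m, G.wordProd m = G.wordProd l → l.length ≤ m.length) : G.IsReduced l := by
  refine le_antisymm (Nat.sInf_le ⟨l, rfl, rfl⟩) (le_csInf ⟨_, l, rfl, rfl⟩ ?_)
  rintro _ ⟨m, rfl, hm⟩
  exact h m hm

theorem IsReduced.of_append {G : SGCM I} {l m : List I} (h : G.IsReduced (l ++ m)) :
    G.IsReduced m := by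
  refine isReduced_of_forall_length_le fun y hy => ?_
  have := h.length_le (m := l ++ y) (by rw [wordProd_append, wordProd_append, hy])
  simp only [List.length_append] at this
  omega

/-- The alternating word `s, t, s, …` with `k` letters. -/
def altWord (s t : I) : ℕ → List I
  | 0 => []
  | k + 1 => s :: altWord t s k

theorem length_altWord (s t : I) (k : ℕ) : (altWord s t k).length = k := by
  induction k generalizing s t with
  | zero => rfl
  | succ k ih => simp [altWord, ih]

theorem exists_altWord_add (s t : I) (m r : ℕ) :
    ∃ u : List I, u.length = r ∧ altWord s t (m + r) = altWord s t m ++ u := by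
  induction m generalizing s t with
  | zero => exact ⟨altWord s t r, length_altWord s t r, by simp [altWord]⟩
  | succ m ih =>
    obtain ⟨u, hu, h⟩ := ih t s
    exact ⟨u, hu, by rw [Nat.succ_add_eq_add_succ]; simp [altWord, h]⟩

/-- An alternating word can be prolonged by one of its two letters, the other one being its
last letter. -/
theorem altWord_succ_eq_append (s t : I) (k : ℕ) :
    ∃ c c' : I, altWord s t (k + 1) = altWord s t k ++ [c] ∧
      altWord s t (k + 2) = altWord s t (k + 1) ++ [c'] ∧
      (c = s ∧ c' = t ∨ c = t ∧ c' = s) := by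
  induction k generalizing s t with
  | zero => exact ⟨s, t, by simp [altWord]⟩
  | succ k ih =>
    obtain ⟨c, c', h, h', hc⟩ := ih t s
    refine ⟨c, c', ?_, ?_, hc.symm⟩
    · rw [altWord, h]; simp [altWord]
    · rw [altWord, h']; simp [altWord]

theorem wordProd_altWord_nonneg_of_four_le (s t : I) (hst : s ≠ t)
    (h4 : 4 ≤ G.a s t * G.a t s) (k : ℕ) (lam : I → ℝ) (hs : 0 ≤ lam s) (ht : 0 ≤ lam t) :
    0 ≤ G.wordProd (altWord t s k) lam s ∧
      0 ≤ 2 * G.wordProd (altWord t s k) lam t - G.a t s * G.wordProd (altWord t s k) lam s := by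
  have h4' : (4 : ℝ) ≤ G.a s t * G.a t s := by exact_mod_cast h4
  have hA : (G.a s t : ℝ) ≤ 0 := by exact_mod_cast G.a_offdiag s t hst
  have hB : (G.a t s : ℝ) ≤ 0 := by exact_mod_cast G.a_offdiag t s hst.symm
  induction k generalizing s t with
  | zero =>
    simp only [altWord, wordProd_nil, Equiv.Perm.one_apply]
    exact ⟨hs, by nlinarith⟩
  | succ k ih =>
    obtain ⟨h1, h2⟩ := ih t s hst.symm (by rwa [mul_comm]) ht hs (by rwa [mul_comm]) hB hA
    simp only [altWord, wordProd_cons, Equiv.Perm.mul_apply, srefl_apply, G.a_diag]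
    set x := G.wordProd (altWord s t k) lam s
    set y := G.wordProd (altWord s t k) lam t
    push_cast
    constructor
    · nlinarith
    · nlinarith

/-- Rank two: either the alternating words starting with `t` all preserve nonnegativity at `s`,
or they do so up to the length of a braid relation. -/
theorem altWord_nonneg_or_braid (s t : I) (hst : s ≠ t) :
    (∀ (k : ℕ) (lam : I → ℝ), 0 ≤ lam s → 0 ≤ lam t →
      0 ≤ G.wordProd (altWord t s k) lam s) ∨
    ∃ m : ℕ, G.wordProd (altWord s t (m + 1)) = G.wordProd (altWord t s (m + 1)) ∧
      ∀ k ≤ m, ∀ lam : I → ℝ, 0 ≤ lam s → 0 ≤ lam t →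
        0 ≤ G.wordProd (altWord t s k) lam s := by
  by_cases h4 : 4 ≤ G.a s t * G.a t s
  · exact Or.inl fun k lam hs ht =>
      (G.wordProd_altWord_nonneg_of_four_le s t hst h4 k lam hs ht).1
  right
  have key : ∀ (A B : ℤ) (m : ℕ), G.a s t = A → G.a t s = B →
      (A = 0 ∧ B = 0 ∧ m = 1 ∨ A = -1 ∧ B = -1 ∧ m = 2 ∨ A = -1 ∧ B = -2 ∧ m = 3 ∨
        A = -2 ∧ B = -1 ∧ m = 3 ∨ A = -1 ∧ B = -3 ∧ m = 5 ∨ A = -3 ∧ B = -1 ∧ m = 5) →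
      G.wordProd (altWord s t (m + 1)) = G.wordProd (altWord t s (m + 1)) ∧
      ∀ k ≤ m, ∀ lam : I → ℝ, 0 ≤ lam s → 0 ≤ lam t →
        0 ≤ G.wordProd (altWord t s k) lam s := by
    rintro A B m hA hB (⟨rfl, rfl, rfl⟩ | ⟨rfl, rfl, rfl⟩ | ⟨rfl, rfl, rfl⟩ | ⟨rfl, rfl, rfl⟩ |
      ⟨rfl, rfl, rfl⟩ | ⟨rfl, rfl, rfl⟩)
    all_goals
      refine ⟨?_, fun k hk lam hs ht => ?_⟩
      · ext lam j
        simp only [altWord, wordProd_cons, wordProd_nil, Equiv.Perm.mul_apply,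
          Equiv.Perm.one_apply, srefl_apply, G.a_diag, hA, hB]
        push_cast
        ring
      · interval_cases k <;>
        · simp only [altWord, wordProd_cons, wordProd_nil, Equiv.Perm.mul_apply,
            Equiv.Perm.one_apply, srefl_apply, G.a_diag, hA, hB]
          push_cast
          linarith
  have hA := G.a_offdiag s t hst
  have hB := G.a_offdiag t s hst.symm
  by_cases hA0 : G.a s t = 0
  · exact ⟨1, key _ _ 1 hA0 (G.a_zero_iff _ _ hA0) (by simp)⟩
  have hB0 : G.a t s ≠ 0 := fun h => hA0 (G.a_zero_iff _ _ h)
  have hA1 : G.a s t ≤ -1 := by omega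
  have hB1 : G.a t s ≤ -1 := by omega
  have hA3 : -3 ≤ G.a s t := by nlinarith
  have hB3 : -3 ≤ G.a t s := by nlinarith
  generalize ha : G.a s t = A at *
  generalize hb : G.a t s = B at *
  interval_cases A <;> interval_cases B <;> first
    | omega
    | (refine ⟨2, key _ _ 2 rfl rfl ?_⟩; omega)
    | (refine ⟨3, key _ _ 3 rfl rfl ?_⟩; omega)
    | (refine ⟨5, key _ _ 5 rfl rfl ?_⟩; omega)

/-- Positivity of (co)roots: if left multiplication by `s` does not decrease the length of the
element expressed by the reduced word `x`, then this element sends dominant weights to weights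
which are nonnegative at `s`. -/
theorem IsReduced.wordProd_nonneg {G : SGCM I} {x : List I} (hx : G.IsReduced x) {s : I}
    (hs : ∀ y, G.wordProd y = G.wordProd (s :: x) → x.length ≤ y.length)
    {lam : I → ℝ} (hlam : ∀ j, 0 ≤ lam j) : 0 ≤ G.wordProd x lam s := by
  induction hn : x.length using Nat.strong_induction_on generalizing x s with
  | _ n ih =>
  subst hn
  rcases x with _ | ⟨t, x'⟩
  · exact hlam s
  have hst : s ≠ t := by
    rintro rfl
    have := hs x' (G.wordProd_cons_cons_self s x').symm
    simp at this
  generalize hxe : t :: x' = x at *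
  let P : ℕ → Prop := fun k =>
    ∃ v : List I, G.wordProd (altWord t s (k + 1) ++ v) = G.wordProd x ∧
      k + 1 + v.length = x.length
  classical
  have hP0 : P 0 := ⟨x', by simp [altWord, ← hxe], by simp [← hxe, add_comm]⟩
  set k := Nat.findGreatest P x.length with hk
  obtain ⟨v, hv, hvl⟩ : P k := Nat.findGreatest_spec (Nat.zero_le _) hP0
  have hmax : ¬ P (k + 1) := by
    intro h
    have h' := h
    obtain ⟨v', -, hvl'⟩ := h'
    have := Nat.le_findGreatest (P := P) (n := x.length) (by omega) h
    omega
  have hred : G.IsReduced (altWord t s (k + 1) ++ v) := by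
    refine isReduced_of_forall_length_le fun y hy => ?_
    have := hx.length_le (hy.trans hv)
    simp only [List.length_append, length_altWord]
    omega
  have hvred := hred.of_append
  obtain ⟨c, c', hc, hc', hcc⟩ := altWord_succ_eq_append t s k
  have hvc : 0 ≤ G.wordProd v lam c := by
    refine ih v.length (by omega) hvred (fun y hy => ?_) rfl
    by_contra! hlt
    have hw : G.wordProd (altWord t s k ++ y) = G.wordProd x := by
      rw [← hv, hc, wordProd_append, hy, ← wordProd_append]; simp
    have := hx.length_le hw
    simp only [List.length_append, length_altWord] at this
    omega
  have hvc' : 0 ≤ G.wordProd v lam c' := by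
    refine ih v.length (by omega) hvred (fun y hy => ?_) rfl
    by_contra! hlt
    have hw : G.wordProd (altWord t s (k + 2) ++ y) = G.wordProd x := by
      rw [← hv, hc', List.append_assoc, wordProd_append, List.singleton_append,
        G.wordProd_cons_congr hy, wordProd_cons_cons_self, ← wordProd_append]
    have := hx.length_le hw
    simp only [List.length_append, length_altWord] at this
    exact hmax ⟨y, hw, by omega⟩
  have hvs : 0 ≤ G.wordProd v lam s ∧ 0 ≤ G.wordProd v lam t := by
    rcases hcc with ⟨rfl, rfl⟩ | ⟨rfl, rfl⟩
    · exact ⟨hvc', hvc⟩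
    · exact ⟨hvc, hvc'⟩
  rw [← hv, wordProd_append, Equiv.Perm.mul_apply]
  rcases G.altWord_nonneg_or_braid s t hst with h | ⟨m, hm, h⟩
  · exact h _ _ hvs.1 hvs.2
  · by_cases hkm : k + 1 ≤ m
    · exact h _ hkm _ hvs.1 hvs.2
    · exfalso
      obtain ⟨u, hu, hmu⟩ := exists_altWord_add t s (m + 1) (k - m)
      rw [show m + 1 + (k - m) = k + 1 by omega] at hmu
      have hw : G.wordProd (altWord t s m ++ u ++ v) = G.wordProd (s :: x) := by
        rw [← G.wordProd_cons_congr hv, hmu, wordProd_cons, wordProd_append, wordProd_append,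
          wordProd_append, wordProd_append, ← hm, altWord, wordProd_cons]
        simp only [← mul_assoc, srefl_mul_self, one_mul]
      have := hs _ hw
      simp only [List.length_append, length_altWord] at this
      omega

theorem wordProd_single_of_notMem [DecidableEq I] (l : List I) (i : I) (hi : i ∉ l) :
    G.wordProd l (Pi.single i 1) = Pi.single i 1 := by
  induction l with
  | nil => rfl
  | cons j l ih =>
    simp only [List.mem_cons, not_or] at hi
    rw [wordProd_cons, Equiv.Perm.mul_apply, ih hi.2]
    funext k
    rw [srefl_apply, Pi.single_eq_of_ne (Ne.symm hi.1), zero_mul, sub_zero]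

/-- Every letter of a reduced word occurs in all words with the same product. -/
theorem IsReduced.mem_of_wordProd_eq {G : SGCM I} {l m : List I} (hl : G.IsReduced l)
    (h : G.wordProd l = G.wordProd m) : ∀ i ∈ l, i ∈ m := by
  classical
  induction l generalizing m with
  | nil => simp
  | cons i l ih =>
    have hlr : G.IsReduced l := IsReduced.of_append (l := [i]) hl
    have hl' : G.wordProd l = G.wordProd (i :: m) := by
      rw [← G.wordProd_cons_congr h, wordProd_cons_cons_self]
    have him : i ∈ m := by
      by_contra him
      have hpos := hlr.wordProd_nonneg (s := i) (lam := Pi.single i 1)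
        (fun y hy => by
          have := hl.length_le hy
          simp only [List.length_cons] at this
          omega)
        (fun j => by
          by_cases hj : j = i
          · subst hj; simp
          · simp [hj])
      rw [hl', wordProd_cons, Equiv.Perm.mul_apply, wordProd_single_of_notMem G m i him,
        srefl_apply, G.a_diag] at hpos
      norm_num at hpos
    intro j hj
    rcases List.mem_cons.1 hj with rfl | hj
    · exact him
    · rcases List.mem_cons.1 (ih hlr hl' j hj) with rfl | hj
      · exact him
      · exact hj

theorem MinusculeWord.wordProd_apply {G : SGCM I} {Λ : I → ℝ} {l : List I}
    (h : G.MinusculeWord Λ l) (j : I) :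
    G.wordProd l Λ j = Λ j - ((l.map fun b => G.a j b).sum : ℤ) := by
  induction l with
  | nil => simp [wordProd_nil]
  | cons i l ih =>
    rw [wordProd_cons, Equiv.Perm.mul_apply, srefl_apply, h.2, ih h.1]
    push_cast [List.map_cons, List.sum_cons]
    ring

theorem MinusculeWord.d_le {G : SGCM I} {Λ : I → ℝ} {iΛ : I} (hΛ : ∀ j, j ≠ iΛ → Λ j = 0)
    {l : List I} (h : G.MinusculeWord Λ l) : ∀ i ∈ l, G.d iΛ ≤ G.d i := by
  induction l with
  | nil => simp
  | cons j l ih =>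
    have ih := ih h.1
    intro i hi
    rcases List.mem_cons.1 hi with rfl | hi
    swap
    · exact ih i hi
    by_cases hiΛ : i = iΛ
    · rw [hiΛ]
    by_cases hil : i ∈ l
    · exact ih i hil
    have hsum : (l.map fun b => G.a i b).sum = -1 := by
      have := h.2
      rw [h.1.wordProd_apply, hΛ i hiΛ] at this
      have h' : (((l.map fun b => G.a i b).sum : ℤ) : ℝ) = ((-1 : ℤ) : ℝ) := by
        push_cast at this ⊢
        linarith
      exact_mod_cast h'
    obtain ⟨b, hb, hab⟩ : ∃ b ∈ l, G.a i b = -1 := by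
      have aux : ∀ l' : List I, i ∉ l' → (l'.map fun b => G.a i b).sum ≤ 0 ∧
          ((l'.map fun b => G.a i b).sum = -1 → ∃ b ∈ l', G.a i b = -1) := by
        intro l' hl'
        induction l' with
        | nil => simp
        | cons b l' ih' =>
          simp only [List.mem_cons, not_or] at hl'
          obtain ⟨h1, h2⟩ := ih' hl'.2
          have hb := G.a_offdiag i b hl'.1
          simp only [List.map_cons, List.sum_cons]
          refine ⟨by omega, fun hs => ?_⟩
          by_cases hb1 : G.a i b = -1
          · exact ⟨b, by simp, hb1⟩
          · obtain ⟨c, hc, hc'⟩ := h2 (by omega)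
            exact ⟨c, by simp [hc], hc'⟩
      exact (aux l hil).2 hsum
    have hba : G.a b i ≤ -1 := by
      have h1 := G.a_offdiag b i (by rintro rfl; exact hil hb)
      have h2 : G.a b i ≠ 0 := fun h0 => by
        have := G.a_zero_iff _ _ h0
        omega
      omega
    have hba' : (G.a b i : ℝ) ≤ -1 := by exact_mod_cast hba
    have hsymm := G.symm i b
    rw [hab] at hsymm
    push_cast at hsymm
    have := ih b hb
    nlinarith [G.d_pos b]

end SGCM

end KM

/-- Let `Λ` be the fundamental weight with simple root `α_Λ` and let
`w = s_{α_1} ⋯ s_{α_l}` be a reduced expression of an element of the Weyl group. If `w`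
is `Λ`-minuscule then no letter `α_i` is shorter than `α_Λ` ((α_i,α_i) ≥ (α_Λ,α_Λ)); if
`w` is `Λ`-cominuscule then no letter `α_i` is longer than `α_Λ`. -/
theorem statement0 {I : Type} (G : KM.SGCM I) (iΛ : I) (Λ : I → ℝ)
    (hfund : Λ iΛ = 1 ∧ ∀ j : I, j ≠ iΛ → Λ j = 0)
    (w : Equiv.Perm (I → ℝ)) (l : List I)
    (hred : G.IsReduced l) (hl : G.wordProd l = w) :
    (G.IsMinuscule Λ w → ∀ i ∈ l, G.normSq iΛ ≤ G.normSq i) ∧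
    (G.IsCominuscule Λ w → ∀ i ∈ l, G.normSq i ≤ G.normSq iΛ) := by
  subst hl
  constructor
  · rintro ⟨m, -, hm, hmin⟩ i hi
    have := hmin.d_le hfund.2 i (hred.mem_of_wordProd_eq hm.symm i hi)
    unfold KM.SGCM.normSq
    linarith
  · rintro ⟨m, -, hm, hmin⟩ i hi
    have : (G.d iΛ)⁻¹ ≤ (G.d i)⁻¹ :=
      hmin.d_le hfund.2 i (hred.mem_of_wordProd_eq hm.symm i hi)
    have := (inv_le_inv₀ (G.d_pos iΛ) (G.d_pos i)).1 this
    unfold KM.SGCM.normSq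
    linarith
end

section
/- Let w be a Λ-minuscule or Λ-cominuscule element of W and let D ⊆ I be the set of indices of the simple roots appearing in a reduced expression of w. Then for all distinct i, j ∈ D with a_{ij} ≠ 0 (where a_{ij} = ⟨α_j, α_i^∨⟩ are the entries of the generalized Cartan matrix), one has a_{ij} = −1 or a_{ji} = −1. -/
namespace KM

namespace SGCM

variable {I : Type} (G : SGCM I)

/-! ## The Weyl group action on the real span of the coroots -/

/-- The pairing of the simple root `α_i` with a combination of simple coroots. -/
noncomputable def rootPairing (i : I) : (I →₀ ℝ) →ₗ[ℝ] ℝ :=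
  Finsupp.linearCombination ℝ fun j => (G.a j i : ℝ)

/-- The simple reflection `s_i` acting on combinations of simple coroots. -/
noncomputable def corefl (i : I) : Module.End ℝ (I →₀ ℝ) :=
  LinearMap.id - (G.rootPairing i).smulRight (Finsupp.single i 1)

/-- The product of the simple reflections along a word, acting on combinations of simple
coroots. -/
noncomputable def coword (l : List I) : Module.End ℝ (I →₀ ℝ) :=
  (l.map G.corefl).prod

/-- The invariant bilinear form on the span of the coroots, normalized by
`(α_i^∨, α_i^∨) = 2 / d i`. -/
noncomputable def coform : (I →₀ ℝ) →ₗ[ℝ] (I →₀ ℝ) →ₗ[ℝ] ℝ :=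
  Finsupp.linearCombination ℝ fun i => (G.d i)⁻¹ • G.rootPairing i

@[simp] lemma rootPairing_single (i j : I) (c : ℝ) :
    G.rootPairing i (Finsupp.single j c) = c * G.a j i := by
  simp [rootPairing]

lemma corefl_apply (i : I) (v : I →₀ ℝ) :
    G.corefl i v = v - G.rootPairing i v • Finsupp.single i 1 := by
  simp [corefl]

lemma corefl_single_self (i : I) :
    G.corefl i (Finsupp.single i 1) = -Finsupp.single i 1 := by
  rw [corefl_apply, rootPairing_single, G.a_diag]
  push_cast
  module

lemma corefl_corefl (i : I) (v : I →₀ ℝ) : G.corefl i (G.corefl i v) = v := by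
  rw [corefl_apply G i v, map_sub, map_smul, corefl_single_self, corefl_apply]
  module

lemma corefl_apply_of_ne {i k : I} (h : i ≠ k) (v : I →₀ ℝ) : G.corefl k v i = v i := by
  simp [corefl_apply, h.symm]

@[simp] lemma coword_nil : G.coword [] = 1 := rfl

lemma coword_cons (i : I) (l : List I) (v : I →₀ ℝ) :
    G.coword (i :: l) v = G.corefl i (G.coword l v) := by
  simp [coword]

lemma coword_append (l m : List I) (v : I →₀ ℝ) :
    G.coword (l ++ m) v = G.coword l (G.coword m v) := by
  simp [coword]

lemma coword_singleton (i : I) : G.coword [i] = G.corefl i := by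
  simp [coword]

lemma coword_coword_reverse (l : List I) (v : I →₀ ℝ) :
    G.coword l (G.coword l.reverse v) = v := by
  induction l generalizing v with
  | nil => simp
  | cons i l ih =>
    rw [List.reverse_cons, coword_append, coword_cons, ih, coword_singleton, corefl_corefl]

lemma coword_apply_of_notMem {i : I} {l : List I} (h : i ∉ l) (v : I →₀ ℝ) :
    G.coword l v i = v i := by
  induction l with
  | nil => simp
  | cons k l ih =>
    rw [List.mem_cons, not_or] at h
    rw [coword_cons, corefl_apply_of_ne G h.1, ih h.2]

lemma coform_single_left (i : I) (c : ℝ) (v : I →₀ ℝ) :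
    G.coform (Finsupp.single i c) v = c * ((G.d i)⁻¹ * G.rootPairing i v) := by
  simp [coform]

lemma coform_comm (u v : I →₀ ℝ) : G.coform u v = G.coform v u := by
  have h : G.coform = G.coform.flip := by
    ext i j
    have hi : G.d i ≠ 0 := (G.d_pos i).ne'
    have hj : G.d j ≠ 0 := (G.d_pos j).ne'
    have hs := G.symm i j
    simp only [LinearMap.comp_apply, Finsupp.lsingle_apply, LinearMap.flip_apply,
      coform_single_left, rootPairing_single]
    field_simp
    linarith
  exact LinearMap.congr_fun₂ h u v

lemma coform_single_single_self (i : I) :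
    G.coform (Finsupp.single i 1) (Finsupp.single i 1) = 2 * (G.d i)⁻¹ := by
  rw [coform_single_left, rootPairing_single, G.a_diag]
  push_cast
  ring

lemma coform_corefl (i : I) (u v : I →₀ ℝ) :
    G.coform (G.corefl i u) (G.corefl i v) = G.coform u v := by
  have h := G.coform_comm u (Finsupp.single i 1)
  rw [coform_single_left] at h
  simp only [corefl_apply, map_sub, map_smul, LinearMap.sub_apply, LinearMap.smul_apply,
    smul_eq_mul, coform_single_left, rootPairing_single, G.a_diag, Int.cast_ofNat, h]
  ring

lemma coform_coword (l : List I) (u v : I →₀ ℝ) :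
    G.coform (G.coword l u) (G.coword l v) = G.coform u v := by
  induction l with
  | nil => simp
  | cons i l ih => rw [coword_cons, coword_cons, coform_corefl, ih]

/-- If `x` maps the coroot `α_i^∨` to a multiple of `α_k^∨`, then `x s_i = s_k x`. -/
lemma coword_corefl_of_coword_single {l : List I} {i k : I} {c : ℝ}
    (h : G.coword l (Finsupp.single i 1) = Finsupp.single k c) (v : I →₀ ℝ) :
    G.coword l (G.corefl i v) = G.corefl k (G.coword l v) := by
  have hi : G.d i ≠ 0 := (G.d_pos i).ne'
  have hk : G.d k ≠ 0 := (G.d_pos k).ne'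
  have hnorm := G.coform_coword l (Finsupp.single i 1) (Finsupp.single i 1)
  rw [h, coform_single_single_self, coform_single_left, rootPairing_single, G.a_diag] at hnorm
  have hpair := G.coform_coword l (Finsupp.single i 1) v
  rw [h, coform_single_left, coform_single_left] at hpair
  have hc : c * c * G.d i = G.d k := by
    push_cast at hnorm
    field_simp at hnorm
    linarith
  have key : G.rootPairing i v * c = G.rootPairing k (G.coword l v) := by
    field_simp at hpair
    have h2 : G.d k * (G.rootPairing i v * c)
        = G.d k * G.rootPairing k (G.coword l v) := by
      linear_combination (-c) * hpair + (G.rootPairing k (G.coword l v)) * hc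
    exact mul_left_cancel₀ hk h2
  rw [corefl_apply, corefl_apply, map_sub, map_smul, h, ← key, Finsupp.smul_single,
    Finsupp.smul_single]
  simp

/-! ## Real coroots are positive or negative -/

/-- All coordinates of `v` have the same sign. -/
def SignCoherent (v : I →₀ ℝ) : Prop := 0 ≤ v ∨ v ≤ 0

lemma SignCoherent.neg {v : I →₀ ℝ} (h : SignCoherent v) : SignCoherent (-v) := by
  rcases h with h | h
  · right; intro j; simpa using h j
  · left; intro j; simpa using h j

/-- A word mapping the coroot `α_i^∨` to a negative vector gets shorter on multiplication
by `s_i`. -/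
lemma exists_coword_eq_of_nonpos {i : I} {p : List I}
    (hcoh : ∀ q : List I, q.length < p.length →
      SignCoherent (G.coword q (Finsupp.single i 1)))
    (hneg : G.coword p (Finsupp.single i 1) ≤ 0) :
    ∃ p' : List I, p'.length + 1 = p.length ∧
      ∀ v, G.coword p (G.corefl i v) = G.coword p' v := by
  induction p with
  | nil =>
    have := hneg i
    simp at this
    linarith
  | cons k p ih =>
    rcases hcoh p (by simp) with hp | hp
    · refine ⟨p, by simp, fun v => ?_⟩
      have hs : G.coword p (Finsupp.single i 1)
          = Finsupp.single k (G.coword p (Finsupp.single i 1) k) := by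
        ext j
        by_cases hj : j = k
        · subst hj; simp
        · rw [Finsupp.single_eq_of_ne hj]
          have h1 := hneg j
          rw [coword_cons, corefl_apply_of_ne G hj] at h1
          exact le_antisymm h1 (hp j)
      rw [coword_cons, G.coword_corefl_of_coword_single hs, corefl_corefl]
    · obtain ⟨p', hlen, hp'⟩ := ih (fun q hq => hcoh q (hq.trans (by simp))) hp
      exact ⟨k :: p', by simpa using hlen, fun v => by rw [coword_cons, coword_cons, hp']⟩

/-- The orbit of `α_i^∨` under the reflections `s_i` and `s_j` consists of integral
combinations of `α_i^∨` and `α_j^∨`. -/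
lemma exists_coword_single_eq {i j : I} {t : List I} (ht : ∀ k ∈ t, k = i ∨ k = j) :
    ∃ x y : ℤ, G.coword t (Finsupp.single i 1)
      = (x : ℝ) • Finsupp.single i 1 + (y : ℝ) • Finsupp.single j 1 := by
  induction t with
  | nil => exact ⟨1, 0, by simp⟩
  | cons k t ih =>
    obtain ⟨x, y, h⟩ := ih fun k hk => ht k (List.mem_cons_of_mem _ hk)
    have hpair : G.rootPairing k (G.coword t (Finsupp.single i 1))
        = ((x * G.a i k + y * G.a j k : ℤ) : ℝ) := by
      rw [h]; simp
    rw [coword_cons, corefl_apply, hpair, h]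
    rcases ht k List.mem_cons_self with rfl | rfl
    · exact ⟨x - (x * G.a k k + y * G.a j k), y, by push_cast; module⟩
    · exact ⟨x, y - (x * G.a i k + y * G.a k k), by push_cast; module⟩

/-- In rank two, sign coherence follows from comparing norms: a vector with coordinates of
opposite signs is longer than both simple coroots. -/
lemma exists_coword_single_eq_same_sign {i j : I} (hij : i ≠ j) {t : List I}
    (ht : ∀ k ∈ t, k = i ∨ k = j) :
    ∃ x y : ℝ, G.coword t (Finsupp.single i 1)
      = x • Finsupp.single i 1 + y • Finsupp.single j 1 ∧
      ((0 ≤ x ∧ 0 ≤ y) ∨ (x ≤ 0 ∧ y ≤ 0)) := by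
  obtain ⟨x, y, h⟩ := G.exists_coword_single_eq ht
  refine ⟨x, y, h, ?_⟩
  by_contra hcon
  have hxy : x * y < 0 := by
    have : ¬ ((0 ≤ x ∧ 0 ≤ y) ∨ (x ≤ 0 ∧ y ≤ 0)) := by exact_mod_cast hcon
    rcases lt_trichotomy x 0 with hx | hx | hx
    · have : 0 < y := by grind
      exact mul_neg_of_neg_of_pos hx this
    · grind
    · have : y < 0 := by grind
      exact mul_neg_of_pos_of_neg hx this
  have hx1 : (1 : ℝ) ≤ (x : ℝ) ^ 2 := by
    have : x ≠ 0 := by rintro rfl; simp at hxy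
    have h0 : 0 < x ^ 2 := by positivity
    exact_mod_cast h0
  have hy1 : (1 : ℝ) ≤ (y : ℝ) ^ 2 := by
    have : y ≠ 0 := by rintro rfl; simp at hxy
    have h0 : 0 < y ^ 2 := by positivity
    exact_mod_cast h0
  have hprod : (0 : ℝ) ≤ (x * y : ℝ) * G.a j i := by
    have : 0 ≤ (x * y) * G.a j i :=
      mul_nonneg_of_nonpos_of_nonpos hxy.le (G.a_offdiag j i hij.symm)
    exact_mod_cast this
  have hdi : 0 < (G.d i)⁻¹ := inv_pos.mpr (G.d_pos i)
  have hdj : 0 < (G.d j)⁻¹ := inv_pos.mpr (G.d_pos j)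
  have hnorm := G.coform_coword t (Finsupp.single i 1) (Finsupp.single i 1)
  have hcomm := G.coform_comm (Finsupp.single j 1) (Finsupp.single i 1)
  have hcross : G.coform (Finsupp.single i 1) (Finsupp.single j 1)
      = (G.d i)⁻¹ * G.a j i := by
    simp [coform_single_left]
  rw [h] at hnorm
  simp only [map_add, map_smul, LinearMap.add_apply, LinearMap.smul_apply, smul_eq_mul,
    coform_single_single_self, hcomm, hcross] at hnorm
  nlinarith [mul_nonneg hdi.le hprod, mul_le_mul_of_nonneg_left hx1 hdi.le,
    mul_le_mul_of_nonneg_left hy1 hdj.le]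

lemma signCoherent_coword_append {n : ℕ}
    (hcoh : ∀ q : List I, q.length < n → ∀ k, SignCoherent (G.coword q (Finsupp.single k 1)))
    {i j : I} (hij : i ≠ j) (u t : List I) (ht : ∀ k ∈ t, k = i ∨ k = j)
    (ht0 : t ≠ []) (hlen : u.length + t.length ≤ n) :
    SignCoherent (G.coword (u ++ t) (Finsupp.single i 1)) := by
  induction hm : u.length generalizing u t with
  | zero =>
    obtain rfl := List.length_eq_zero_iff.mp hm
    obtain ⟨x, y, h, hs⟩ := G.exists_coword_single_eq_same_sign hij ht
    rw [List.nil_append, h]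
    have hi : (0 : I →₀ ℝ) ≤ Finsupp.single i 1 := by simp
    have hj : (0 : I →₀ ℝ) ≤ Finsupp.single j 1 := by simp
    rcases hs with ⟨hx, hy⟩ | ⟨hx, hy⟩
    · exact .inl (add_nonneg (smul_nonneg hx hi) (smul_nonneg hy hj))
    · exact .inr (add_nonpos (smul_nonpos_of_nonpos_of_nonneg hx hi)
        (smul_nonpos_of_nonpos_of_nonneg hy hj))
  | succ m ih =>
    have htpos : 0 < t.length := List.length_pos_iff.mpr ht0
    have step : ∀ k, (k = i ∨ k = j) → G.coword u (Finsupp.single k 1) ≤ 0 →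
        SignCoherent (G.coword (u ++ t) (Finsupp.single i 1)) := by
      intro k hk hneg
      obtain ⟨p, hp, hpv⟩ :=
        G.exists_coword_eq_of_nonpos (fun q hq => hcoh q (by omega) k) hneg
      have := ih p (k :: t) (by simpa [hk] using ht) (by simp)
        (by simp only [List.length_cons]; omega) (by omega)
      rwa [coword_append, coword_cons, ← hpv, corefl_corefl, ← coword_append] at this
    rcases hcoh u (by omega) i with hi | hi
    · rcases hcoh u (by omega) j with hj | hj
      · obtain ⟨x, y, h, hs⟩ := G.exists_coword_single_eq_same_sign hij ht
        rw [coword_append, h, map_add, map_smul, map_smul]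
        rcases hs with ⟨hx, hy⟩ | ⟨hx, hy⟩
        · exact .inl (add_nonneg (smul_nonneg hx hi) (smul_nonneg hy hj))
        · exact .inr (add_nonpos (smul_nonpos_of_nonpos_of_nonneg hx hi)
            (smul_nonpos_of_nonpos_of_nonneg hy hj))
      · exact step j (.inr rfl) hj
    · exact step i (.inl rfl) hi

/-- Every real coroot is a nonnegative or a nonpositive combination of simple coroots. -/
theorem signCoherent_coword_single (u : List I) (i : I) :
    SignCoherent (G.coword u (Finsupp.single i 1)) := by
  induction hn : u.length using Nat.strong_induction_on generalizing u i with
  | _ n ih =>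
    rcases List.eq_nil_or_concat u with rfl | ⟨u', j, rfl⟩
    · left; simp
    · rw [List.concat_eq_append] at hn ⊢
      by_cases hij : i = j
      · subst hij
        rw [coword_append, coword_singleton, corefl_single_self, map_neg]
        exact (ih u'.length (by simp at hn; omega) u' i rfl).neg
      · exact G.signCoherent_coword_append (fun q hq k => ih _ hq q k rfl) hij u' [j]
          (by simp) (by simp) (by simpa using hn.le)

/-! ## The support of a reduced word -/

lemma exists_eq_append_cons_of_not_subset {l m : List I} (h : ¬ l ⊆ m) :
    ∃ p i q, l = p ++ i :: q ∧ i ∉ m ∧ q ⊆ m := by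
  induction l with
  | nil => simp at h
  | cons k l ih =>
    by_cases hl : l ⊆ m
    · exact ⟨[], k, l, rfl, fun hk => h (List.cons_subset.mpr ⟨hk, hl⟩), hl⟩
    · obtain ⟨p, i, q, rfl, hi, hq⟩ := ih hl
      exact ⟨k :: p, i, q, rfl, hi, hq⟩

/-- A word using a letter not needed to express its product can be shortened. -/
lemma exists_shorter_coword {l m : List I} (h : G.coword l = G.coword m) (hlm : ¬ l ⊆ m) :
    ∃ l' : List I, l'.length < l.length ∧ G.coword l' = G.coword l := by
  obtain ⟨p, i, q, rfl, hi, hq⟩ := exists_eq_append_cons_of_not_subset hlm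
  have hiq : i ∉ q.reverse := fun hmem => hi (hq (List.mem_reverse.mp hmem))
  have hcoef := G.coword_apply_of_notMem hi (G.coword q.reverse (Finsupp.single i 1))
  rw [G.coword_apply_of_notMem hiq, ← h, coword_append, coword_cons, coword_coword_reverse,
    corefl_single_self, map_neg, Finsupp.neg_apply, Finsupp.single_eq_same] at hcoef
  have hneg : G.coword p (Finsupp.single i 1) ≤ 0 := by
    rcases G.signCoherent_coword_single p i with hp | hp
    · have : 0 ≤ G.coword p (Finsupp.single i 1) i := hp i
      linarith
    · exact hp
  obtain ⟨p', hlen, hp'⟩ :=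
    G.exists_coword_eq_of_nonpos (fun r _ => G.signCoherent_coword_single r i) hneg
  refine ⟨p' ++ q, by simp; omega, LinearMap.ext fun v => ?_⟩
  rw [coword_append, coword_append, coword_cons, hp']

lemma wordProd_cons_apply (i : I) (l : List I) (Λ : I → ℝ) (j : I) :
    G.wordProd (i :: l) Λ j = G.wordProd l Λ j - G.wordProd l Λ i * G.a j i := by
  simp only [wordProd, List.map_cons, List.prod_cons, Equiv.Perm.mul_apply]
  rfl

/-- The actions on weights and on coroots are contragredient. -/
lemma linearCombination_wordProd (l : List I) (Λ : I → ℝ) (v : I →₀ ℝ) :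
    Finsupp.linearCombination ℝ (G.wordProd l Λ) v
      = Finsupp.linearCombination ℝ Λ (G.coword l.reverse v) := by
  induction l generalizing v with
  | nil => simp [wordProd]
  | cons i l ih =>
    rw [List.reverse_cons, coword_append, coword_singleton, ← ih]
    induction v using Finsupp.induction_linear with
    | zero => simp
    | add u v hu hv => simp only [map_add, hu, hv]
    | single j c =>
      simp only [corefl_apply, Finsupp.linearCombination_single, map_sub, map_smul,
        rootPairing_single, wordProd_cons_apply, smul_eq_mul]
      ring

lemma wordProd_eq_iff {l m : List I} :
    G.wordProd l = G.wordProd m ↔ G.coword l.reverse = G.coword m.reverse := by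
  classical
  constructor
  · intro h
    refine LinearMap.ext fun v => Finsupp.ext fun j => ?_
    have hj : ∀ u : I →₀ ℝ, Finsupp.linearCombination ℝ (Pi.single j (1 : ℝ)) u = u j := by
      intro u
      simp
    rw [← hj, ← hj, ← linearCombination_wordProd, ← linearCombination_wordProd, h]
  · intro h
    refine Equiv.ext fun Λ => funext fun j => ?_
    have hl := G.linearCombination_wordProd l Λ (Finsupp.single j 1)
    have hm := G.linearCombination_wordProd m Λ (Finsupp.single j 1)
    rw [h, ← hm] at hl
    simpa using hl

/-- The letters of a reduced word occur in every word with the same product. -/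
theorem IsReduced.subset {G : SGCM I} {l m : List I} (hl : G.IsReduced l)
    (h : G.wordProd l = G.wordProd m) : l ⊆ m := by
  by_contra hlm
  obtain ⟨l', hlen, hl'⟩ :=
    G.exists_shorter_coword (G.wordProd_eq_iff.mp h) (by simpa [List.subset_def] using hlm)
  have hprod : G.wordProd l'.reverse = G.wordProd l :=
    G.wordProd_eq_iff.mpr (by simpa using hl')
  have hle : G.length (G.wordProd l) ≤ l'.length := Nat.sInf_le ⟨_, by simp, hprod⟩
  rw [hl] at hle
  simp at hlen
  omega

/-! ## Minuscule words -/

lemma MinusculeWord.wordProd_apply_of_notMem {G : SGCM I} {Λ : I → ℝ} (hdom : ∀ i, 0 ≤ Λ i)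
    {l : List I} (hl : G.MinusculeWord Λ l) {j : I} (hj : j ∉ l) :
    0 ≤ G.wordProd l Λ j ∧ ∀ i ∈ l, -(G.a j i : ℝ) ≤ G.wordProd l Λ j := by
  induction l with
  | nil => simpa [wordProd] using hdom j
  | cons k l ih =>
    rw [List.mem_cons, not_or] at hj
    obtain ⟨h0, h1⟩ := ih hl.1 hj.2
    have hk : (G.a j k : ℝ) ≤ 0 := by exact_mod_cast G.a_offdiag j k hj.1
    rw [wordProd_cons_apply, hl.2]
    refine ⟨by linarith, fun i hi => ?_⟩
    rcases List.mem_cons.mp hi with rfl | hi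
    · linarith
    · linarith [h1 i hi]

lemma MinusculeWord.apply_eq_neg_one {G : SGCM I} {Λ : I → ℝ} (hdom : ∀ i, 0 ≤ Λ i)
    {j : I} {l : List I} (hl : G.MinusculeWord Λ (j :: l)) (hj : j ∉ l) {i : I} (hi : i ∈ l)
    (hne : G.a j i ≠ 0) : G.a j i = -1 := by
  have h := (hl.1.wordProd_apply_of_notMem hdom hj).2 i hi
  rw [hl.2] at h
  have h1 : -G.a j i ≤ 1 := by exact_mod_cast h
  have h2 := G.a_offdiag j i (fun hji => hj (hji ▸ hi))
  omega

theorem MinusculeWord.eq_neg_one_or {G : SGCM I} {Λ : I → ℝ} (hdom : ∀ i, 0 ≤ Λ i)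
    {l : List I} (hl : G.MinusculeWord Λ l) {i j : I} (hi : i ∈ l) (hj : j ∈ l)
    (hij : i ≠ j) (hne : G.a i j ≠ 0) : G.a i j = -1 ∨ G.a j i = -1 := by
  induction l with
  | nil => simp at hi
  | cons k l ih =>
    by_cases hil : i ∈ l
    · by_cases hjl : j ∈ l
      · exact ih hl.1 hil hjl
      · obtain rfl := (List.mem_cons.mp hj).resolve_right hjl
        exact .inr (hl.apply_eq_neg_one hdom hjl hil fun h => hne (G.a_zero_iff _ _ h))
    · obtain rfl := (List.mem_cons.mp hi).resolve_right hil
      have hjl : j ∈ l := (List.mem_cons.mp hj).resolve_left hij.symm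
      exact .inl (hl.apply_eq_neg_one hdom hil hjl hne)

end SGCM

end KM

/-- Let `w` be a `Λ`-minuscule or `Λ`-cominuscule element (`Λ` dominant)
and let `D` be the set of (indices of) simple roots appearing in a reduced expression of
`w`. Then for all distinct `i, j ∈ D` with `a i j ≠ 0` one has `a i j = -1` or
`a j i = -1`. -/
theorem statement3 {I : Type} (G : KM.SGCM I) (Λ : I → ℝ) (hdom : ∀ i, 0 ≤ Λ i)
    (w : Equiv.Perm (I → ℝ)) (hw : G.IsCoMin Λ w)
    (l : List I) (hred : G.IsReduced l) (hl : G.wordProd l = w)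
    (i j : I) (hi : i ∈ l) (hj : j ∈ l) (hij : i ≠ j) (hne : G.a i j ≠ 0) :
    G.a i j = -1 ∨ G.a j i = -1 := by
  rcases hw with ⟨m, -, hm, hmin⟩ | ⟨m, -, hm, hmin⟩
  · have hsub := hred.subset (hl.trans hm.symm)
    exact hmin.eq_neg_one_or hdom (hsub hi) (hsub hj) hij hne
  · have hsub := hred.subset (hl.trans hm.symm)
    exact hmin.eq_neg_one_or hdom (hsub hj) (hsub hi) hij.symm hne
end
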